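/- Assume the nondegeneracy assumption (8.2.8) and that J(C) is nonempty. For I ∈ J(C) let γ_I = inf{ ∏_{i∈I} |m_i| : m ∈ M_I } and let γ = inf{ γ_I : I ∈ J(C) } (a positive number). Let R(t) = (N/2)·α·log t − (N/2)·log log √t − N·log(K·α^(α/2)·2√π) + (d/2)·log(2π), and let I(y) = |y|²/2 + (d/2)·log(2π). Then, with B_t = { y ∈ ℝ^d : ⟨C·S_α⁻¹(Φ(y)), S_α⁻¹(Φ(y))⟩ ≥ t }, one has inf{ I(y) : y ∈ B_t } = R(t) + α·log γ + o(1) as t → ∞. -/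

import Mathlib

open MeasureTheory Filter Set Asymptotics
open scoped Topology Classical

noncomputable section

/-- The quadratic form `⟨Cx, x⟩`. -/
def quadForm {d : ℕ} (C : Matrix (Fin d) (Fin d) ℝ) (x : Fin d → ℝ) : ℝ :=
  ∑ i, (∑ j, C i j * x j) * x i

/-- `x` lies in `V_I = span{e_i : i ∈ I}`. -/
def suppIn {d : ℕ} (I : Finset (Fin d)) (x : Fin d → ℝ) : Prop :=
  ∀ i ∉ I, x i = 0

/-- `N(C)`, the minimal cardinality of a set `I` such that `⟨Cu,u⟩ > 0` for some `u ∈ V_I`. -/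
def Ncal {d : ℕ} (C : Matrix (Fin d) (Fin d) ℝ) : ℕ :=
  sInf {n | ∃ I : Finset (Fin d), I.card = n ∧ ∃ u : Fin d → ℝ, suppIn I u ∧ 0 < quadForm C u}

/-- `J(C)`, the sets `I` of minimal cardinality `N(C)` carrying a vector with `⟨Cu,u⟩ > 0`. -/
def Jcal {d : ℕ} (C : Matrix (Fin d) (Fin d) ℝ) : Set (Finset (Fin d)) :=
  {I | I.card = Ncal C ∧ ∃ u : Fin d → ℝ, suppIn I u ∧ 0 < quadForm C u}

/-- `M_I = {m ∈ V_I : ⟨Cm,m⟩ = 1}`. -/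
def Mman {d : ℕ} (C : Matrix (Fin d) (Fin d) ℝ) (I : Finset (Fin d)) : Set (Fin d → ℝ) :=
  {m | suppIn I m ∧ quadForm C m = 1}

/-- The nondegeneracy assumption (8.2.8). -/
def Nondeg {d : ℕ} (C : Matrix (Fin d) (Fin d) ℝ) : Prop :=
  ∀ I : Finset (Fin d), I.card < Ncal C →
    ∀ u : Fin d → ℝ, suppIn I u → u ≠ 0 → quadForm C u < 0

/-- The standard normal cumulative distribution function `Φ`. -/
def normCDF (y : ℝ) : ℝ := ∫ u in Iic y, Real.exp (-u ^ 2 / 2) / Real.sqrt (2 * Real.pi)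

lemma integrable_stdDens :
    Integrable (fun u : ℝ => Real.exp (-u ^ 2 / 2) / Real.sqrt (2 * Real.pi)) := by
  have h := integrable_exp_neg_mul_sq (b := 1 / 2) (by norm_num)
  refine (h.div_const (Real.sqrt (2 * Real.pi))).congr (ae_of_all _ fun u => ?_)
  simp only
  congr 2; ring

lemma integral_stdDens :
    ∫ u : ℝ, Real.exp (-u ^ 2 / 2) / Real.sqrt (2 * Real.pi) = 1 := by
  have h := integral_gaussian (1 / 2)
  rw [integral_div, div_eq_one_iff_eq (by positivity)]
  rw [show 2 * Real.pi = Real.pi / (1 / 2) by ring, ← h]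
  refine integral_congr_ae (ae_of_all _ fun u => ?_)
  simp only
  congr 1; ring

lemma hasDerivAt_normCDF (y : ℝ) :
    HasDerivAt normCDF (Real.exp (-y ^ 2 / 2) / Real.sqrt (2 * Real.pi)) y := by
  have hcont : Continuous fun u : ℝ => Real.exp (-u ^ 2 / 2) / Real.sqrt (2 * Real.pi) := by
    fun_prop
  have h1 := intervalIntegral.integral_hasDerivAt_right (a := 0) (b := y)
    (hcont.intervalIntegrable _ _) hcont.stronglyMeasurable.stronglyMeasurableAtFilter
    hcont.continuousAt
  refine (h1.const_add (normCDF 0)).congr_of_eventuallyEq (Eventually.of_forall fun x => ?_)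
  have := intervalIntegral.integral_Iic_sub_Iic (a := 0) (b := x)
    integrable_stdDens.integrableOn integrable_stdDens.integrableOn
  simp only [normCDF]
  rw [← this]; ring

lemma normCDF_strictMono : StrictMono normCDF :=
  strictMono_of_deriv_pos fun y => by
    rw [(hasDerivAt_normCDF y).deriv]; positivity

lemma normCDF_neg (y : ℝ) : normCDF (-y) = 1 - normCDF y := by
  have h1 := intervalIntegral.integral_Iic_add_Ioi (b := y)
    integrable_stdDens.integrableOn integrable_stdDens.integrableOn
  rw [integral_stdDens] at h1
  have h2 := integral_comp_neg_Iic (-y)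
    fun u : ℝ => Real.exp (-u ^ 2 / 2) / Real.sqrt (2 * Real.pi)
  simp only [neg_neg, neg_sq] at h2
  simp only [normCDF, h2]
  linarith

lemma tendsto_normCDF_atBot : Tendsto normCDF atBot (𝓝 0) :=
  tendsto_integral_Iic_zero tendsto_id

lemma tendsto_normCDF_atTop : Tendsto normCDF atTop (𝓝 1) := by
  have h := (tendsto_normCDF_atBot.comp tendsto_neg_atTop_atBot).const_sub 1
  simpa [Function.comp_def, normCDF_neg] using h

lemma normCDF_mem_Ioo (y : ℝ) : normCDF y ∈ Ioo (0 : ℝ) 1 := by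
  refine ⟨?_, ?_⟩
  · refine lt_of_le_of_lt ?_ (normCDF_strictMono (sub_one_lt y))
    exact normCDF_strictMono.monotone.le_of_tendsto tendsto_normCDF_atBot _
  · refine lt_of_lt_of_le (normCDF_strictMono (lt_add_one y)) ?_
    exact normCDF_strictMono.monotone.ge_of_tendsto tendsto_normCDF_atTop _

lemma exists_normCDF_eq {p : ℝ} (hp : p ∈ Ioo (0 : ℝ) 1) : ∃ y, normCDF y = p := by
  have hc : Continuous normCDF :=
    continuous_iff_continuousAt.2 fun y => (hasDerivAt_normCDF y).continuousAt
  obtain ⟨a, ha⟩ := (tendsto_normCDF_atBot.eventually (gt_mem_nhds hp.1)).exists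
  obtain ⟨b, hb⟩ := (tendsto_normCDF_atTop.eventually (lt_mem_nhds hp.2)).exists
  exact mem_range_of_exists_le_of_exists_ge hc ⟨a, ha.le⟩ ⟨b, hb.le⟩

lemma normCDF_tail_isEquivalent :
    (fun y => 1 - normCDF y) ~[atTop]
      fun y => Real.exp (-y ^ 2 / 2) / Real.sqrt (2 * Real.pi) / y := by
  refine (isEquivalent_iff_tendsto_one ?_).2 ?_
  · filter_upwards [eventually_gt_atTop 0] with y hy
    positivity
  have hdens : ∀ y : ℝ, HasDerivAt
      (fun u : ℝ => Real.exp (-u ^ 2 / 2) / Real.sqrt (2 * Real.pi))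
      (-y * (Real.exp (-y ^ 2 / 2) / Real.sqrt (2 * Real.pi))) y := fun y => by
    have h : HasDerivAt (fun u : ℝ => -u ^ 2 / 2) (-y) y := by
      have := ((hasDerivAt_pow 2 y).neg).div_const 2
      refine this.congr_deriv ?_
      push_cast
      ring
    refine ((h.exp).div_const (Real.sqrt (2 * Real.pi))).congr_deriv ?_
    ring
  refine HasDerivAt.lhopital_zero_atTop
    (f' := fun y => -(Real.exp (-y ^ 2 / 2) / Real.sqrt (2 * Real.pi)))
    (g' := fun y => -(Real.exp (-y ^ 2 / 2) / Real.sqrt (2 * Real.pi)) * (1 + (y ^ 2)⁻¹))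
    (Eventually.of_forall fun y => (hasDerivAt_normCDF y).const_sub 1) ?_ ?_ ?_ ?_ ?_
  · filter_upwards [eventually_gt_atTop 0] with y hy
    refine ((hdens y).div (hasDerivAt_id y) hy.ne').congr_deriv ?_
    rw [id]
    field_simp
    ring
  · filter_upwards [eventually_gt_atTop 0] with y hy
    have : 0 < Real.exp (-y ^ 2 / 2) / Real.sqrt (2 * Real.pi) * (1 + (y ^ 2)⁻¹) := by positivity
    linarith
  · simpa using tendsto_normCDF_atTop.const_sub 1
  · refine squeeze_zero' (g := fun y : ℝ => (1 / Real.sqrt (2 * Real.pi)) / y) ?_ ?_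
      (tendsto_const_nhds.div_atTop tendsto_id)
    · filter_upwards [eventually_gt_atTop 0] with y hy
      positivity
    · filter_upwards [eventually_gt_atTop 0] with y hy
      gcongr
      rw [Real.exp_le_one_iff]
      nlinarith
  · have h : Tendsto (fun y : ℝ => (1 + (y ^ 2)⁻¹)⁻¹) atTop (𝓝 1) := by
      have := (tendsto_inv_atTop_zero.comp (tendsto_pow_atTop (α := ℝ) two_ne_zero)).const_add 1
      simpa using this.inv₀ (by norm_num)
    refine h.congr' ?_
    filter_upwards [eventually_gt_atTop 0] with y hy
    have : Real.exp (-y ^ 2 / 2) / Real.sqrt (2 * Real.pi) ≠ 0 := by positivity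
    have h3 : (1 + (y ^ 2)⁻¹) ≠ 0 := by positivity
    field_simp

lemma tendsto_atTop_of_normCDF_tail {y : ℝ → ℝ}
    (h : Tendsto (fun x => 1 - normCDF (y x)) atTop (𝓝 0)) : Tendsto y atTop atTop := by
  refine tendsto_atTop.2 fun M => ?_
  have hM : 0 < 1 - normCDF M := by linarith [(normCDF_mem_Ioo M).2]
  filter_upwards [h.eventually (gt_mem_nhds hM)] with x hx
  exact (normCDF_strictMono.lt_iff_lt.1 (by linarith)).le

lemma normal_quantile_asymptotic {α A : ℝ} (hα : 0 < α) (hA : 0 < A) {y : ℝ → ℝ}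
    (h : (fun x => 1 - normCDF (y x)) ~[atTop] fun x => A / x ^ α) :
    Tendsto (fun x => y x ^ 2 / 2 - (α * Real.log x - Real.log (Real.log x) / 2 -
      Real.log (A * Real.sqrt α * (2 * Real.sqrt Real.pi)))) atTop (𝓝 0) := by
  have hy : Tendsto y atTop atTop := by
    refine tendsto_atTop_of_normCDF_tail (h.symm.tendsto_nhds ?_)
    exact tendsto_const_nhds.div_atTop (tendsto_rpow_atTop hα)
  have hy0 : ∀ᶠ x in atTop, 0 < y x := hy.eventually_gt_atTop 0
  have hlog : Tendsto Real.log atTop atTop := Real.tendsto_log_atTop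
  have hE := (normCDF_tail_isEquivalent.comp_tendsto hy).symm.trans h
  rw [isEquivalent_iff_tendsto_one (by
    filter_upwards [eventually_gt_atTop 0] with x hx
    positivity)] at hE
  have hE1 := (hE.log one_ne_zero).neg
  simp only [Real.log_one, neg_zero] at hE1
  have h1 : Tendsto (fun x => y x ^ 2 / 2 + Real.log (y x) +
      (Real.log (Real.sqrt (2 * Real.pi)) + Real.log A) - α * Real.log x) atTop (𝓝 0) := by
    refine hE1.congr' ?_
    filter_upwards [hy0, eventually_gt_atTop 0] with x hx hx0
    have hpi : 0 < Real.sqrt (2 * Real.pi) := by positivity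
    simp only [Function.comp_apply, Pi.div_apply]
    rw [Real.log_div (by positivity) (by positivity), Real.log_div (by positivity) hx.ne',
      Real.log_div (by positivity) hpi.ne', Real.log_div hA.ne' (by positivity),
      Real.log_exp, Real.log_rpow hx0]
    ring
  have hsq : Tendsto (fun x => y x ^ 2 / 2) atTop atTop :=
    ((tendsto_pow_atTop two_ne_zero).comp hy).atTop_div_const two_pos
  have hlogy : Tendsto (fun x => Real.log (y x) / (y x ^ 2 / 2)) atTop (𝓝 0) := by
    have := (Real.isLittleO_log_id_atTop.trans
      ((isLittleO_pow_pow_atTop_of_lt (𝕜 := ℝ) one_lt_two).congr_left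
        (fun x => by simp))).tendsto_div_nhds_zero.comp hy
    have := this.const_mul 2
    rw [mul_zero] at this
    refine this.congr fun x => ?_
    simp only [Function.comp_apply]
    ring
  have h2 : Tendsto (fun x => α * Real.log x / (y x ^ 2 / 2)) atTop (𝓝 1) := by
    have h3 := (h1.sub_const (Real.log (Real.sqrt (2 * Real.pi)) + Real.log A)).div_atTop hsq
    have h4 := (hlogy.sub h3).const_add 1
    simp only [sub_zero, add_zero] at h4
    refine h4.congr' ?_
    filter_upwards [hy0] with x hx
    field_simp
    ring
  have h5 := h2.log one_ne_zero
  rw [Real.log_one] at h5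
  have h6 := h1.add (h5.div_const 2)
  simp only [zero_div, add_zero] at h6
  refine h6.congr' ?_
  filter_upwards [hy0, hlog.eventually_gt_atTop 0] with x hx hx1
  rw [Real.log_div (by positivity) (by positivity), Real.log_mul hα.ne' hx1.ne',
    Real.log_div (by positivity) two_ne_zero, Real.log_pow, Real.log_mul (by positivity)
    (by positivity), Real.log_mul hA.ne' (by positivity), Real.log_mul two_ne_zero (by positivity),
    Real.log_sqrt hα.le, Real.log_sqrt Real.pi_pos.le, Real.log_sqrt (by positivity),
    Real.log_mul two_ne_zero Real.pi_pos.ne']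
  push_cast
  ring

/-- The asymptotic profile `α log T - (log log T)/2 - κ` of the one-dimensional cost. -/
def costProfile (α κ T : ℝ) : ℝ := α * Real.log T - Real.log (Real.log T) / 2 - κ

/-- `ψ x` is asymptotic to `costProfile α κ |x|` as `|x| → ∞`. -/
def HasCostProfile (α κ : ℝ) (ψ : ℝ → ℝ) : Prop :=
  ∀ ε > 0, ∃ X, ∀ x, X ≤ |x| → |ψ x - costProfile α κ (|x|)| ≤ ε

lemma abs_log_one_add_le {w : ℝ} (hw : |w| ≤ 1 / 2) : |Real.log (1 + w)| ≤ 2 * |w| := by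
  obtain ⟨h1, h2⟩ := abs_le.1 hw
  have hpos : 0 < 1 + w := by linarith
  have hup := Real.log_le_sub_one_of_pos hpos
  have hlow := Real.one_sub_inv_le_log_of_pos hpos
  have hw' : -(2 * |w|) ≤ 1 - (1 + w)⁻¹ := by
    rw [show 1 - (1 + w)⁻¹ = w / (1 + w) by field_simp; ring, le_div_iff₀ hpos]
    rcases abs_cases w with ⟨h, _⟩ | ⟨h, _⟩ <;> rw [h] <;> nlinarith
  rw [abs_le]
  exact ⟨by linarith, by linarith [le_abs_self w, abs_nonneg w]⟩

lemma HasCostProfile.uniform {α κ : ℝ} {ψ : ℝ → ℝ} (hψ : HasCostProfile α κ ψ)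
    {a b : ℝ} (ha : 0 < a) {ε : ℝ} (hε : 0 < ε) :
    ∀ᶠ T in atTop, ∀ z, a ≤ |z| → |z| ≤ b →
      |ψ (T * z) - (costProfile α κ T + α * Real.log (|z|))| ≤ ε := by
  obtain ⟨X, hX⟩ := hψ (ε / 2) (half_pos hε)
  set M := |Real.log a| + |Real.log b| with hM
  have hlog := Real.tendsto_log_atTop
  filter_upwards [eventually_gt_atTop 0, eventually_ge_atTop (X / a),
    hlog.eventually_ge_atTop 1, hlog.eventually_ge_atTop (2 * M),
    hlog.eventually_ge_atTop (2 * M / ε)] with T hT hTX h1 h2 h3 z haz hzb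
  have hz : 0 < |z| := ha.trans_le haz
  have hl : |Real.log (|z|)| ≤ M := by
    have e1 := Real.log_le_log ha haz
    have e2 := Real.log_le_log hz hzb
    rw [abs_le]
    constructor <;>
    linarith [neg_abs_le (Real.log a), le_abs_self (Real.log b), abs_nonneg (Real.log a),
      abs_nonneg (Real.log b)]
  have hlT : 0 < Real.log T := by linarith
  set w := Real.log |z| / Real.log T with hw
  have hwabs : |w| ≤ M / Real.log T := by
    rw [hw, abs_div, abs_of_pos hlT]
    gcongr
  have hw1 : |w| ≤ 1 / 2 := hwabs.trans (by rw [div_le_iff₀ hlT]; linarith)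
  have hw2 : |w| ≤ ε / 2 := hwabs.trans (by
    rw [div_le_iff₀ hε] at h3
    rw [div_le_iff₀ hlT]; linarith)
  have hw3 := abs_log_one_add_le hw1
  have habs : |T * z| = T * |z| := by rw [abs_mul, abs_of_pos hT]
  have hkey := hX (T * z) (by
    rw [habs]
    calc X ≤ T * a := by rwa [div_le_iff₀ ha] at hTX
      _ ≤ T * |z| := by gcongr)
  have hll : Real.log (Real.log (T * |z|)) = Real.log (Real.log T) + Real.log (1 + w) := by
    have : 0 < 1 + w := by linarith [(abs_le.1 hw1).1]
    rw [← Real.log_mul hlT.ne' this.ne', Real.log_mul hT.ne' hz.ne', hw]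
    congr 1
    field_simp
  rw [habs] at hkey
  unfold costProfile at *
  rw [hll, Real.log_mul hT.ne' hz.ne'] at hkey
  rw [abs_le] at hw3 hkey ⊢
  constructor <;> linarith [hkey.1, hkey.2, hw3.1, hw3.2]

lemma HasCostProfile.lower_bound {α κ : ℝ} {ψ : ℝ → ℝ} (hα : 0 < α)
    (hψ : HasCostProfile α κ ψ) {a : ℝ} (ha : 0 < a) :
    ∃ D, ∀ᶠ T in atTop, ∀ z, a ≤ |z| →
      costProfile α κ T + α / 2 * Real.log |z| - D ≤ ψ (T * z) := by
  obtain ⟨X, hX⟩ := hψ 1 one_pos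
  refine ⟨1 + |Real.log a| * (α / 2), ?_⟩
  have hlog := Real.tendsto_log_atTop
  filter_upwards [eventually_gt_atTop 0, eventually_ge_atTop (X / a),
    hlog.eventually_ge_atTop 1, hlog.eventually_ge_atTop (1 / α),
    hlog.eventually_ge_atTop (1 + |Real.log a|)] with T hT hTX h1 h2 h3 z haz
  have hz : 0 < |z| := ha.trans_le haz
  have hl := Real.log_le_log ha haz
  have hl' : -|Real.log a| ≤ Real.log |z| := (neg_abs_le _).trans hl
  have hlT : 0 < Real.log T := by linarith
  have habs : |T * z| = T * |z| := by rw [abs_mul, abs_of_pos hT]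
  have hkey := hX (T * z) (by
    rw [habs]
    calc X ≤ T * a := by rwa [div_le_iff₀ ha] at hTX
      _ ≤ T * |z| := by gcongr)
  have hll : Real.log (Real.log (T * |z|)) ≤
      Real.log (Real.log T) + Real.log |z| / Real.log T := by
    have hp : 0 < 1 + Real.log |z| / Real.log T := by
      rw [← neg_lt_iff_pos_add', lt_div_iff₀ hlT]; linarith
    have := Real.log_le_sub_one_of_pos hp
    rw [Real.log_mul hT.ne' hz.ne', show Real.log T + Real.log |z| =
      Real.log T * (1 + Real.log |z| / Real.log T) by field_simp, Real.log_mul hlT.ne' hp.ne']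
    linarith
  rw [habs] at hkey
  unfold costProfile at *
  rw [Real.log_mul hT.ne' hz.ne'] at hkey hll
  have hinv : (Real.log T)⁻¹ ≤ α := inv_le_of_inv_le₀ hα (by simpa using h2)
  have hinv0 : 0 < (Real.log T)⁻¹ := inv_pos.2 hlT
  rw [div_eq_mul_inv (Real.log |z|)] at hll
  have hq : -(|Real.log a| * (α / 2)) ≤ Real.log |z| * (α / 2 - (Real.log T)⁻¹ / 2) := by
    have e1 : -|Real.log a| * (α / 2 - (Real.log T)⁻¹ / 2) ≤
        Real.log |z| * (α / 2 - (Real.log T)⁻¹ / 2) :=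
      mul_le_mul_of_nonneg_right hl' (by linarith)
    nlinarith [mul_nonneg (abs_nonneg (Real.log a)) hinv0.le]
  nlinarith [(abs_le.1 hkey).1]

lemma HasCostProfile.bounded_of_le {α κ : ℝ} {ψ : ℝ → ℝ} (hα : 0 < α)
    (hψ : HasCostProfile α κ ψ) (E : ℝ) : ∃ L, ∀ x, ψ x ≤ E → |x| ≤ L := by
  obtain ⟨D, hD⟩ := hψ.lower_bound hα one_pos
  obtain ⟨T, hT, hT0⟩ := (hD.and (eventually_gt_atTop 0)).exists
  refine ⟨T * max 1 (Real.exp ((E + D - costProfile α κ T) / (α / 2))), fun x hx => ?_⟩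
  have hxz : x = T * (x / T) := by field_simp
  have habs : |x| = T * |x / T| := by rw [abs_div, abs_of_pos hT0]; field_simp
  rw [habs]
  refine mul_le_mul_of_nonneg_left ?_ hT0.le
  rcases le_total |x / T| 1 with h | h
  · exact h.trans (le_max_left _ _)
  · refine le_max_of_le_right ?_
    have h1 := hT _ h
    rw [← hxz] at h1
    rw [← Real.log_le_iff_le_exp (by linarith), le_div_iff₀ (by positivity)]
    linarith

lemma quadForm_smul {d : ℕ} (C : Matrix (Fin d) (Fin d) ℝ) (s : ℝ) (x : Fin d → ℝ) :
    quadForm C (s • x) = s ^ 2 * quadForm C x := by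
  simp only [quadForm, Pi.smul_apply, smul_eq_mul, Finset.mul_sum, Finset.sum_mul]
  refine Finset.sum_congr rfl fun i _ => Finset.sum_congr rfl fun j _ => ?_
  ring

lemma continuous_quadForm {d : ℕ} (C : Matrix (Fin d) (Fin d) ℝ) : Continuous (quadForm C) := by
  unfold quadForm
  fun_prop

lemma exists_norm_lower_bound {d : ℕ} (C : Matrix (Fin d) (Fin d) ℝ) :
    ∃ c > 0, ∀ z : Fin d → ℝ, 1 ≤ quadForm C z → c ≤ ‖z‖ := by
  have h0 : quadForm C 0 = 0 := by simp [quadForm]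
  have h : ∀ᶠ z in 𝓝 (0 : Fin d → ℝ), quadForm C z < 1 :=
    (continuous_quadForm C).continuousAt.eventually (gt_mem_nhds (by rw [h0]; exact one_pos))
  obtain ⟨c, hc, hcz⟩ := Metric.eventually_nhds_iff.1 h
  refine ⟨c, hc, fun z hz => ?_⟩
  by_contra! hlt
  exact absurd (hcz (by simpa using hlt)) (not_lt.2 hz)

lemma exists_card_eq_Ncal {d : ℕ} {C : Matrix (Fin d) (Fin d) ℝ}
    (hpos : ∃ u : Fin d → ℝ, 0 < quadForm C u) :
    ∃ I : Finset (Fin d), I.card = Ncal C ∧ ∃ u : Fin d → ℝ, suppIn I u ∧ 0 < quadForm C u := by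
  obtain ⟨u, hu⟩ := hpos
  have hne : {n | ∃ I : Finset (Fin d), I.card = n ∧
      ∃ u : Fin d → ℝ, suppIn I u ∧ 0 < quadForm C u}.Nonempty :=
    ⟨_, Finset.univ, rfl, u, fun i hi => absurd (Finset.mem_univ i) hi, hu⟩
  exact Nat.sInf_mem hne

lemma Ncal_pos {d : ℕ} {C : Matrix (Fin d) (Fin d) ℝ}
    (hpos : ∃ u : Fin d → ℝ, 0 < quadForm C u) : 0 < Ncal C := by
  obtain ⟨I, hI, u, hu, hq⟩ := exists_card_eq_Ncal hpos
  rw [← hI, Finset.card_pos, Finset.nonempty_iff_ne_empty]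
  rintro rfl
  have : u = 0 := funext fun i => hu i (Finset.notMem_empty i)
  simp [this, quadForm] at hq

lemma Nondeg.exists_coord_bound {d : ℕ} {C : Matrix (Fin d) (Fin d) ℝ} (hC : Nondeg C)
    {I : Finset (Fin d)} (hI : I.card < Ncal C) :
    ∃ c > 0, ∀ x : Fin d → ℝ, ‖x‖ = 1 → 0 ≤ quadForm C x → ∃ i ∉ I, c ≤ |x i| := by
  set f : (Fin d → ℝ) → ℝ := fun x => ‖fun i => if i ∈ I then 0 else x i‖ with hf
  have hfc : Continuous f := by
    refine continuous_norm.comp (continuous_pi fun i => ?_)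
    split_ifs <;> fun_prop
  have hK : IsCompact (Metric.sphere (0 : Fin d → ℝ) 1 ∩ {x | 0 ≤ quadForm C x}) :=
    (isCompact_sphere 0 1).inter_right (isClosed_le continuous_const (continuous_quadForm C))
  rcases (Metric.sphere (0 : Fin d → ℝ) 1 ∩ {x | 0 ≤ quadForm C x}).eq_empty_or_nonempty
    with he | hne
  · refine ⟨1, one_pos, fun x hx hq => ?_⟩
    have : x ∈ Metric.sphere (0 : Fin d → ℝ) 1 ∩ {x | 0 ≤ quadForm C x} := ⟨by simpa using hx, hq⟩
    simp [he] at this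
  obtain ⟨x₀, ⟨hx₀, hq₀⟩, hmin⟩ := hK.exists_isMinOn hne hfc.continuousOn
  have hpos : 0 < f x₀ := by
    refine norm_pos_iff.2 fun h0 => ?_
    have hsupp : suppIn I x₀ := fun i hi => by simpa [hi] using congrFun h0 i
    have hx0 : x₀ ≠ 0 := by rintro rfl; simp at hx₀
    exact absurd (hC I hI x₀ hsupp hx0) (not_lt.2 hq₀)
  refine ⟨f x₀, hpos, fun x hx hq => ?_⟩
  by_contra! hlt
  have h1 : f x₀ ≤ f x := hmin ⟨by simpa using hx, hq⟩
  refine absurd h1 (not_le.2 ?_)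
  refine (pi_norm_lt_iff hpos).2 fun i => ?_
  by_cases hi : i ∈ I
  · simpa [hi] using hpos
  · simpa [hi] using hlt i hi

lemma Nondeg.exists_large_coords {d : ℕ} {C : Matrix (Fin d) (Fin d) ℝ} (hC : Nondeg C)
    (hpos : ∃ u : Fin d → ℝ, 0 < quadForm C u) :
    ∃ c > 0, ∀ x : Fin d → ℝ, 0 ≤ quadForm C x →
      ∃ I : Finset (Fin d), I.card = Ncal C ∧ ∀ i ∈ I, c * ‖x‖ ≤ |x i| := by
  have h : ∀ I : Finset (Fin d), ∀ᶠ c in 𝓝[>] (0 : ℝ), I.card < Ncal C →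
      ∀ x : Fin d → ℝ, ‖x‖ = 1 → 0 ≤ quadForm C x → ∃ i ∉ I, c ≤ |x i| := fun I => by
    by_cases hI : I.card < Ncal C
    · obtain ⟨c, hc, hcx⟩ := hC.exists_coord_bound hI
      filter_upwards [Ioc_mem_nhdsGT hc] with c' hc' _ x hx hq
      obtain ⟨i, hi, hci⟩ := hcx x hx hq
      exact ⟨i, hi, hc'.2.trans hci⟩
    · exact Eventually.of_forall fun c h => absurd h hI
  obtain ⟨c, hcI, hc⟩ := ((eventually_all.2 h).and self_mem_nhdsWithin).exists
  refine ⟨c, hc, fun x hq => ?_⟩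
  rcases eq_or_ne x 0 with rfl | hx
  · obtain ⟨I, hI, -⟩ := exists_card_eq_Ncal hpos
    exact ⟨I, hI, fun i _ => by simp⟩
  have hn : 0 < ‖x‖ := norm_pos_iff.2 hx
  have hcard : Ncal C ≤ (Finset.univ.filter fun i => c * ‖x‖ ≤ |x i|).card := by
    by_contra! hlt
    obtain ⟨i, hi, hci⟩ := hcI _ hlt (‖x‖⁻¹ • x) (by simp [norm_smul, hn.ne'])
      (by rw [quadForm_smul]; positivity)
    refine hi (Finset.mem_filter.2 ⟨Finset.mem_univ i, ?_⟩)
    rw [Pi.smul_apply, smul_eq_mul, abs_mul, abs_of_pos (inv_pos.2 hn)] at hci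
    field_simp at hci
    linarith
  obtain ⟨I, hIs, hI⟩ := Finset.exists_subset_card_eq hcard
  exact ⟨I, hI, fun i hi => (Finset.mem_filter.1 (hIs hi)).2⟩

lemma exists_pos_le_prod_abs {d : ℕ} {C : Matrix (Fin d) (Fin d) ℝ} (hC : Nondeg C)
    (hpos : ∃ u : Fin d → ℝ, 0 < quadForm C u) :
    ∃ c > 0, ∀ I ∈ Jcal C, ∀ m ∈ Mman C I, (∀ i ∈ I, m i ≠ 0) ∧ c ≤ ∏ i ∈ I, |m i| := by
  obtain ⟨c, hc, hcx⟩ := hC.exists_large_coords hpos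
  obtain ⟨c₁, hc₁, hcz⟩ := exists_norm_lower_bound C
  refine ⟨(c * c₁) ^ Ncal C, by positivity, fun I hI m hm => ?_⟩
  obtain ⟨I', hI', hm'⟩ := hcx m (by rw [hm.2]; exact zero_le_one)
  have hle : ∀ i ∈ I', c * c₁ ≤ |m i| := fun i hi =>
    (mul_le_mul_of_nonneg_left (hcz m hm.2.ge) hc.le).trans (hm' i hi)
  have hsub : I' ⊆ I := fun i hi => by
    by_contra hiI
    have := hle i hi
    rw [hm.1 i hiI, abs_zero] at this
    exact absurd this (not_le.2 (by positivity))
  obtain rfl : I' = I := Finset.eq_of_subset_of_card_le hsub (by rw [hI', hI.1])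
  refine ⟨fun i hi h0 => ?_, ?_⟩
  · have := hle i hi
    rw [h0, abs_zero] at this
    exact absurd this (not_le.2 (by positivity))
  · rw [← hI', ← Finset.prod_const]
    exact Finset.prod_le_prod (fun i _ => by positivity) hle

/-- Lower bound for the total cost on `{x | T² ≤ ⟨Cx,x⟩}`. -/
lemma sum_cost_lower_bound {d : ℕ} {C : Matrix (Fin d) (Fin d) ℝ} (hC : Nondeg C)
    (hpos : ∃ u : Fin d → ℝ, 0 < quadForm C u) {α κ Γ : ℝ} {ψ : ℝ → ℝ} (hα : 0 < α)
    (hψ : HasCostProfile α κ ψ) (hψ0 : ∀ x, 0 ≤ ψ x)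
    (hΓ : ∀ I : Finset (Fin d), I.card = Ncal C → ∀ m : Fin d → ℝ, suppIn I m →
      0 < quadForm C m → Γ + (Ncal C : ℝ) / 2 * Real.log (quadForm C m) ≤
        ∑ i ∈ I, Real.log |m i|)
    {ε : ℝ} (hε : 0 < ε) :
    ∀ᶠ T in atTop, ∀ x : Fin d → ℝ, T ^ 2 ≤ quadForm C x →
      (Ncal C : ℝ) * costProfile α κ T + α * Γ - ε ≤ ∑ i, ψ (x i) := by
  have hN : (0 : ℝ) < Ncal C := by exact_mod_cast Ncal_pos hpos
  set N : ℝ := (Ncal C : ℝ) with hNdef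
  obtain ⟨c, hc, hlarge⟩ := hC.exists_large_coords hpos
  obtain ⟨c₁, hc₁, hnorm⟩ := exists_norm_lower_bound C
  have ha : 0 < c * c₁ := mul_pos hc hc₁
  obtain ⟨D, hD⟩ := hψ.lower_bound hα ha
  set b := Real.exp ((α * Γ + N * D) / (N * (α / 2))) / c with hb
  obtain ⟨L, hL⟩ := hψ.bounded_of_le hα (α * Γ + N * D + N * (α / 2) * |Real.log (c * c₁)|)
  set η := 1 - Real.exp (-(ε / (α * N))) with hη
  have hη0 : 0 < η := by
    have : Real.exp (-(ε / (α * N))) < 1 := Real.exp_lt_one_iff.2 (neg_lt_zero.2 (by positivity))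
    linarith
  have hunif := (isCompact_closedBall (0 : Fin d → ℝ) b).uniformContinuousOn_of_continuous
    (continuous_quadForm C).continuousOn
  obtain ⟨δ, hδ, hclose⟩ := Metric.uniformContinuousOn_iff.1 hunif η hη0
  filter_upwards [eventually_gt_atTop 0, eventually_gt_atTop (L / δ), hD,
    hψ.uniform (b := b) ha (ε := ε / (2 * N)) (by positivity)] with T hT hTL hDT hUT x hx
  by_contra! hlt
  obtain ⟨z, rfl⟩ : ∃ z : Fin d → ℝ, x = T • z :=
    ⟨T⁻¹ • x, by rw [smul_smul, mul_inv_cancel₀ hT.ne', one_smul]⟩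
  simp only [Pi.smul_apply, smul_eq_mul] at hlt
  have hqz : 1 ≤ quadForm C z := by
    rw [quadForm_smul] at hx
    have : 0 < T ^ 2 := by positivity
    nlinarith
  have hzn := hnorm z hqz
  obtain ⟨I, hI, hIz⟩ := hlarge z (by linarith)
  have hlo : c * c₁ ≤ c * ‖z‖ := by gcongr
  have hcz : 0 < c * ‖z‖ := ha.trans_le hlo
  have hsplit : ∑ i, ψ (T * z i) = ∑ i ∈ I, ψ (T * z i) + ∑ i ∈ Iᶜ, ψ (T * z i) :=
    (Finset.sum_add_sum_compl I _).symm
  have hrest : ∀ s : Finset (Fin d), 0 ≤ ∑ i ∈ s, ψ (T * z i) :=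
    fun s => Finset.sum_nonneg fun i _ => hψ0 _
  have hIsum : N * (costProfile α κ T + α / 2 * Real.log (c * ‖z‖) - D) ≤
      ∑ i ∈ I, ψ (T * z i) := by
    rw [hNdef, ← hI, ← nsmul_eq_mul]
    refine Finset.card_nsmul_le_sum _ _ _ fun i hi => ?_
    have h1 := hDT (z i) (hlo.trans (hIz i hi))
    have h2 := Real.log_le_log hcz (hIz i hi)
    nlinarith
  have hzb : ‖z‖ ≤ b := by
    have h1 : Real.log (c * ‖z‖) * (N * (α / 2)) ≤ α * Γ + N * D := by
      nlinarith [hrest Iᶜ]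
    rw [← le_div_iff₀ (by positivity), Real.log_le_iff_le_exp hcz] at h1
    rw [hb, le_div_iff₀ hc]
    linarith
  have hlogz : -|Real.log (c * c₁)| ≤ Real.log (c * ‖z‖) :=
    (neg_abs_le _).trans (Real.log_le_log ha hlo)
  have hsmall : ∀ i ∉ I, |z i| < δ := fun i hi => by
    have h1 : ψ (T * z i) ≤ ∑ i ∈ Iᶜ, ψ (T * z i) :=
      Finset.single_le_sum (f := fun i => ψ (T * z i)) (fun j _ => hψ0 _)
        (Finset.mem_compl.2 hi)
    have h2 : N * (α / 2) * (-|Real.log (c * c₁)|) ≤ N * (α / 2) * Real.log (c * ‖z‖) := by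
      gcongr
    have h3 := hL (T * z i) (by nlinarith)
    rw [abs_mul, abs_of_pos hT] at h3
    rw [div_lt_iff₀ hδ] at hTL
    exact lt_of_mul_lt_mul_left (h3.trans_lt hTL) hT.le
  set w : Fin d → ℝ := fun i => if i ∈ I then z i else 0 with hw
  have hwI : ∀ i ∈ I, w i = z i := fun i hi => by simp [hw, hi]
  have hwn : ‖w‖ ≤ ‖z‖ := (pi_norm_le_iff_of_nonneg (norm_nonneg z)).2 fun i => by
    by_cases hi : i ∈ I
    · rw [hwI i hi]; exact norm_le_pi_norm z i
    · simp [hw, hi]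
  have hdist : dist z w < δ := (dist_pi_lt_iff hδ).2 fun i => by
    by_cases hi : i ∈ I
    · rwa [hwI i hi, dist_self]
    · simpa [hw, hi] using hsmall i hi
  have hqw := hclose z (by simpa using hzb) w (by simpa using hwn.trans hzb) hdist
  rw [Real.dist_eq] at hqw
  have hqw' : Real.exp (-(ε / (α * N))) ≤ quadForm C w := by
    linarith [(abs_lt.1 hqw).2]
  have hqw0 : 0 < quadForm C w := (Real.exp_pos _).trans_le hqw'
  have hlogq : -(ε / (α * N)) ≤ Real.log (quadForm C w) := (Real.le_log_iff_exp_le hqw0).2 hqw'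
  have hprod := hΓ I hI w (fun i hi => by simp [hw, hi]) hqw0
  have hIsum' : N * (costProfile α κ T - ε / (2 * N)) + α * ∑ i ∈ I, Real.log |w i| ≤
      ∑ i ∈ I, ψ (T * z i) := by
    rw [hNdef, ← hI, ← nsmul_eq_mul, ← Finset.sum_const, Finset.mul_sum,
      ← Finset.sum_add_distrib]
    refine Finset.sum_le_sum fun i hi => ?_
    have h1 := hUT (z i) (hlo.trans (hIz i hi)) ((norm_le_pi_norm z i).trans hzb)
    rw [hwI i hi, hI]
    linarith [(abs_le.1 h1).1]
  have h4 : α * (Γ + N / 2 * (-(ε / (α * N)))) ≤ α * ∑ i ∈ I, Real.log |w i| := by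
    refine mul_le_mul_of_nonneg_left (le_trans ?_ hprod) hα.le
    gcongr
  have h5 : α * (Γ + N / 2 * (-(ε / (α * N)))) = α * Γ - ε / 2 := by field_simp; ring
  have h6 : N * (costProfile α κ T - ε / (2 * N)) = N * costProfile α κ T - ε / 2 := by
    field_simp
  linarith [hrest Iᶜ]

/-- Upper bound for the minimal total cost on `{x | T² ≤ ⟨Cx,x⟩}`. -/
lemma exists_sum_cost_le {d : ℕ} {C : Matrix (Fin d) (Fin d) ℝ} {α κ Γ : ℝ} {ψ : ℝ → ℝ}
    (hα : 0 < α) (hψ : HasCostProfile α κ ψ) {c₀ : ℝ} (hc₀ : ψ c₀ = 0)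
    (hΓ : ∀ ε > 0, ∃ I : Finset (Fin d), I.card = Ncal C ∧ ∃ m : Fin d → ℝ, suppIn I m ∧
      quadForm C m = 1 ∧ (∀ i ∈ I, m i ≠ 0) ∧ ∑ i ∈ I, Real.log |m i| ≤ Γ + ε)
    {ε : ℝ} (hε : 0 < ε) :
    ∀ᶠ T in atTop, ∃ x : Fin d → ℝ, T ^ 2 ≤ quadForm C x ∧
      ∑ i, ψ (x i) ≤ (Ncal C : ℝ) * costProfile α κ T + α * Γ + ε := by
  set N : ℝ := (Ncal C : ℝ) with hNdef
  have hN0 : 0 ≤ N := Nat.cast_nonneg _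
  set ε₁ := ε / (α + N * α + N + 1) with hε₁
  have hden : 0 < α + N * α + N + 1 := by positivity
  have hε₁0 : 0 < ε₁ := by positivity
  have hsum : α * ε₁ + N * α * ε₁ + N * ε₁ ≤ ε := by
    have : ε₁ * (α + N * α + N + 1) = ε := by rw [hε₁]; field_simp
    nlinarith
  obtain ⟨I, hI, m, hm, hqm, hm0, hmΓ⟩ := hΓ ε₁ hε₁0
  set s := Real.exp ε₁ with hs
  have hs1 : 1 < s := Real.one_lt_exp_iff.2 hε₁0
  have hs0 : 0 < s := Real.exp_pos _
  set v : ℝ → Fin d → ℝ := fun h => s • m + h • fun i => if i ∈ I then 0 else c₀ with hv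
  have hv0 : Tendsto (fun T : ℝ => quadForm C (v T⁻¹)) atTop (𝓝 (s ^ 2)) := by
    have h1 : Continuous fun h => quadForm C (v h) := by
      refine (continuous_quadForm C).comp ?_
      fun_prop
    have h2 : quadForm C (v 0) = s ^ 2 := by simp [hv, quadForm_smul, hqm]
    have h3 := h1.tendsto 0
    rw [h2] at h3
    exact h3.comp tendsto_inv_atTop_zero
  have hcost : ∀ᶠ T in atTop, ∀ i : Fin d, i ∈ I →
      ψ (T * (s * m i)) ≤ costProfile α κ T + α * (ε₁ + Real.log |m i|) + ε₁ := by
    refine eventually_all.2 fun i => ?_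
    by_cases hi : i ∈ I
    · have habs : 0 < |m i| := abs_pos.2 (hm0 i hi)
      have hsm : |s * m i| = s * |m i| := by rw [abs_mul, abs_of_pos hs0]
      filter_upwards [hψ.uniform (a := |s * m i|) (b := |s * m i|) (by rw [hsm]; positivity)
        hε₁0] with T hT _
      have h1 := (abs_le.1 (hT (s * m i) le_rfl le_rfl)).2
      rw [hsm, Real.log_mul hs0.ne' habs.ne', hs, Real.log_exp] at h1
      linarith
    · exact Eventually.of_forall fun T h => absurd h hi
  filter_upwards [eventually_gt_atTop 0, hcost,
    hv0.eventually (lt_mem_nhds (show 1 < s ^ 2 by nlinarith))] with T hT hcT hqT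
  refine ⟨T • v T⁻¹, ?_, ?_⟩
  · rw [quadForm_smul]
    have : 0 < T ^ 2 := by positivity
    nlinarith
  have hin : ∀ i ∈ I, (T • v T⁻¹) i = T * (s * m i) := fun i hi => by simp [hv, hi]
  have hout : ∀ i ∈ Iᶜ, ψ ((T • v T⁻¹) i) = 0 := fun i hi => by
    have hi' := Finset.mem_compl.1 hi
    have : (T • v T⁻¹) i = c₀ := by
      simp only [hv, Pi.smul_apply, Pi.add_apply, smul_eq_mul, hi', if_false, hm i hi']
      field_simp
      ring
    rw [this, hc₀]
  rw [← Finset.sum_add_sum_compl I, Finset.sum_eq_zero hout, add_zero]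
  calc ∑ i ∈ I, ψ ((T • v T⁻¹) i)
      ≤ ∑ i ∈ I, ((costProfile α κ T + α * ε₁ + ε₁) + α * Real.log |m i|) := by
        refine Finset.sum_le_sum fun i hi => ?_
        rw [hin i hi]
        linarith [hcT i hi]
    _ = N * (costProfile α κ T + α * ε₁ + ε₁) + α * ∑ i ∈ I, Real.log |m i| := by
        rw [Finset.sum_add_distrib, Finset.sum_const, nsmul_eq_mul, hI, Finset.mul_sum]
    _ ≤ N * costProfile α κ T + α * Γ + ε := by
        have := mul_le_mul_of_nonneg_left hmΓ hα.le
        linarith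

lemma inv_sqrt_smul_mem_Mman {d : ℕ} {C : Matrix (Fin d) (Fin d) ℝ} {I : Finset (Fin d)}
    {m : Fin d → ℝ} (hm : suppIn I m) (hq : 0 < quadForm C m) :
    (Real.sqrt (quadForm C m))⁻¹ • m ∈ Mman C I := by
  refine ⟨fun i hi => by simp [hm i hi], ?_⟩
  rw [quadForm_smul, inv_pow, Real.sq_sqrt hq.le, inv_mul_cancel₀ hq.ne']

section InfProduct

variable {d : ℕ} {C : Matrix (Fin d) (Fin d) ℝ} {γI : Finset (Fin d) → ℝ} {γ : ℝ}

lemma infProd_le_prod (hγI : ∀ I, γI I = sInf {r : ℝ | ∃ m ∈ Mman C I, r = ∏ i ∈ I, |m i|})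
    {I : Finset (Fin d)} {m : Fin d → ℝ} (hm : m ∈ Mman C I) : γI I ≤ ∏ i ∈ I, |m i| := by
  rw [hγI]
  refine csInf_le ⟨0, ?_⟩ ⟨m, hm, rfl⟩
  rintro r ⟨m', -, rfl⟩
  exact Finset.prod_nonneg fun i _ => abs_nonneg _

lemma le_infProd (hγI : ∀ I, γI I = sInf {r : ℝ | ∃ m ∈ Mman C I, r = ∏ i ∈ I, |m i|})
    {c : ℝ} (hc : ∀ I ∈ Jcal C, ∀ m ∈ Mman C I, c ≤ ∏ i ∈ I, |m i|)
    {I : Finset (Fin d)} (hI : I ∈ Jcal C) : c ≤ γI I := by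
  rw [hγI]
  obtain ⟨u, hu, hq⟩ := hI.2
  refine le_csInf ⟨_, _, inv_sqrt_smul_mem_Mman hu hq, rfl⟩ ?_
  rintro r ⟨m, hm, rfl⟩
  exact hc I hI m hm

lemma infProd_pos (hC : Nondeg C) (hpos : ∃ u : Fin d → ℝ, 0 < quadForm C u)
    (hγI : ∀ I, γI I = sInf {r : ℝ | ∃ m ∈ Mman C I, r = ∏ i ∈ I, |m i|})
    (hγ : γ = sInf {r : ℝ | ∃ I ∈ Jcal C, r = γI I}) : 0 < γ := by
  obtain ⟨c, hc, hcm⟩ := exists_pos_le_prod_abs hC hpos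
  obtain ⟨I, hI⟩ := exists_card_eq_Ncal hpos
  refine hc.trans_le ?_
  rw [hγ]
  refine le_csInf ⟨_, I, hI, rfl⟩ ?_
  rintro r ⟨I', hI', rfl⟩
  exact le_infProd hγI (fun I hI m hm => (hcm I hI m hm).2) hI'

lemma log_infProd_le (hC : Nondeg C) (hpos : ∃ u : Fin d → ℝ, 0 < quadForm C u)
    (hγI : ∀ I, γI I = sInf {r : ℝ | ∃ m ∈ Mman C I, r = ∏ i ∈ I, |m i|})
    (hγ : γ = sInf {r : ℝ | ∃ I ∈ Jcal C, r = γI I})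
    {I : Finset (Fin d)} (hI : I.card = Ncal C) {m : Fin d → ℝ} (hm : suppIn I m)
    (hq : 0 < quadForm C m) :
    Real.log γ + (Ncal C : ℝ) / 2 * Real.log (quadForm C m) ≤ ∑ i ∈ I, Real.log |m i| := by
  obtain ⟨c, hc, hcm⟩ := exists_pos_le_prod_abs hC hpos
  have hIJ : I ∈ Jcal C := ⟨hI, m, hm, hq⟩
  have hmM := inv_sqrt_smul_mem_Mman hm hq
  have hle : γ ≤ ∏ i ∈ I, |((Real.sqrt (quadForm C m))⁻¹ • m) i| := by
    refine le_trans ?_ (infProd_le_prod hγI hmM)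
    rw [hγ]
    refine csInf_le ⟨c, ?_⟩ ⟨I, hIJ, rfl⟩
    rintro r ⟨I', hI', rfl⟩
    exact le_infProd hγI (fun I hI m hm => (hcm I hI m hm).2) hI'
  have hne := (hcm I hIJ _ hmM).1
  have hlog := Real.log_le_log (infProd_pos hC hpos hγI hγ) hle
  rw [Real.log_prod (fun i hi => (abs_pos.2 (hne i hi)).ne')] at hlog
  have hterm : ∀ i ∈ I, Real.log |((Real.sqrt (quadForm C m))⁻¹ • m) i| =
      Real.log |m i| - Real.log (quadForm C m) / 2 := fun i hi => by
    have hmi : m i ≠ 0 := fun h => hne i hi (by simp [h])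
    have hs : 0 < Real.sqrt (quadForm C m) := Real.sqrt_pos.2 hq
    rw [Pi.smul_apply, smul_eq_mul, abs_mul, abs_of_pos (inv_pos.2 hs),
      Real.log_mul (inv_pos.2 hs).ne' (abs_pos.2 hmi).ne', Real.log_inv, Real.log_sqrt hq.le]
    ring
  rw [Finset.sum_congr rfl hterm, Finset.sum_sub_distrib, Finset.sum_const, nsmul_eq_mul,
    hI] at hlog
  linarith

lemma exists_sum_log_le (hC : Nondeg C) (hpos : ∃ u : Fin d → ℝ, 0 < quadForm C u)
    (hγI : ∀ I, γI I = sInf {r : ℝ | ∃ m ∈ Mman C I, r = ∏ i ∈ I, |m i|})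
    (hγ : γ = sInf {r : ℝ | ∃ I ∈ Jcal C, r = γI I}) {ε : ℝ} (hε : 0 < ε) :
    ∃ I : Finset (Fin d), I.card = Ncal C ∧ ∃ m : Fin d → ℝ, suppIn I m ∧
      quadForm C m = 1 ∧ (∀ i ∈ I, m i ≠ 0) ∧ ∑ i ∈ I, Real.log |m i| ≤ Real.log γ + ε := by
  obtain ⟨c, hc, hcm⟩ := exists_pos_le_prod_abs hC hpos
  have hγ0 := infProd_pos hC hpos hγI hγ
  have hlt : γ < γ * Real.exp ε := lt_mul_of_one_lt_right hγ0 (Real.one_lt_exp_iff.2 hε)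
  obtain ⟨I₀, hI₀⟩ := exists_card_eq_Ncal hpos
  have hneJ : {r : ℝ | ∃ I ∈ Jcal C, r = γI I}.Nonempty := ⟨_, I₀, hI₀, rfl⟩
  obtain ⟨_, ⟨I, hI, rfl⟩, hIlt⟩ := exists_lt_of_csInf_lt hneJ (hγ.symm.trans_lt hlt)
  obtain ⟨u, hu, hq⟩ := hI.2
  rw [hγI] at hIlt
  have hneM : {r : ℝ | ∃ m ∈ Mman C I, r = ∏ i ∈ I, |m i|}.Nonempty :=
    ⟨_, _, inv_sqrt_smul_mem_Mman hu hq, rfl⟩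
  obtain ⟨_, ⟨m, hm, rfl⟩, hmlt⟩ := exists_lt_of_csInf_lt hneM hIlt
  obtain ⟨hne, hcle⟩ := hcm I hI m hm
  refine ⟨I, hI.1, m, hm.1, hm.2, hne, ?_⟩
  rw [← Real.log_prod (fun i hi => (abs_pos.2 (hne i hi)).ne')]
  have := Real.log_le_log (hc.trans_le hcle) hmlt.le
  rwa [Real.log_mul hγ0.ne' (Real.exp_pos _).ne', Real.log_exp] at this

end InfProduct

/-- The squared normal quantile of a distribution function with two-sided tail `A / x ^ α`. -/
lemma hasCostProfile_normal_quantile {α A : ℝ} (hα : 0 < α) (hA : 0 < A) {S Y : ℝ → ℝ}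
    (hY : ∀ x, normCDF (Y x) = S x)
    (hleft : (fun x => S (-x)) ~[atTop] fun x => A / x ^ α)
    (hright : (fun x => 1 - S x) ~[atTop] fun x => A / x ^ α) :
    HasCostProfile α (Real.log (A * Real.sqrt α * (2 * Real.sqrt Real.pi)))
      fun x => Y x ^ 2 / 2 := by
  have h1 := normal_quantile_asymptotic (y := Y) hα hA (by simpa only [hY] using hright)
  have h2 := normal_quantile_asymptotic (y := fun x => -Y (-x)) hα hA
    (by simpa only [normCDF_neg, sub_sub_cancel, hY] using hleft)
  intro ε hε
  obtain ⟨X₁, hX₁⟩ := eventually_atTop.1 (Metric.tendsto_nhds.1 h1 ε hε)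
  obtain ⟨X₂, hX₂⟩ := eventually_atTop.1 (Metric.tendsto_nhds.1 h2 ε hε)
  refine ⟨max X₁ X₂, fun x hx => ?_⟩
  rcases le_total 0 x with h | h
  · rw [abs_of_nonneg h] at hx ⊢
    simpa [costProfile] using (hX₁ x ((le_max_left _ _).trans hx)).le
  · rw [abs_of_nonpos h] at hx ⊢
    simpa [costProfile] using (hX₂ (-x) ((le_max_right _ _).trans hx)).le

/-- **Lemma 8.2.13 (first part).** Under (8.2.8), with
`γ_I = inf{∏_{i∈I} |m_i| : m ∈ M_I}`, `γ = inf{γ_I : I ∈ J(C)}`,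
`R(t) = (N/2) α log t − (N/2) log log √t − N log(K α^(α/2) 2√π) + (d/2) log(2π)` and
`I(y) = |y|²/2 + (d/2) log(2π)`, one has
`inf{I(y) : y ∈ B_t} = R(t) + α log γ + o(1)` as `t → ∞`. -/
theorem inf_I_on_Bt_asymptotic
    {d : ℕ}
    (α K : ℝ) (hα : 0 < α) (hK : 0 < K)
    (sα Sα Sαinv : ℝ → ℝ)
    (hs_cont : Continuous sα) (hs_pos : ∀ x, 0 < sα x)
    (hSα : ∀ x, Sα x = ∫ u in Iic x, sα u)
    (hrange : ∀ x, Sα x ∈ Ioo (0 : ℝ) 1)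
    (hinv_left : ∀ x, Sαinv (Sα x) = x)
    (hinv_right : ∀ p ∈ Ioo (0 : ℝ) 1, Sα (Sαinv p) = p)
    (htail_left : (fun x => Sα (-x)) ~[atTop] fun x => K * α ^ ((α - 1) / 2) / x ^ α)
    (htail_right : (fun x => 1 - Sα x) ~[atTop] fun x => K * α ^ ((α - 1) / 2) / x ^ α)
    (C : Matrix (Fin d) (Fin d) ℝ)
    (hpos : ∃ u : Fin d → ℝ, 0 < quadForm C u)
    (hnondeg : Nondeg C)
    (γI : Finset (Fin d) → ℝ)
    (hγI : ∀ I, γI I = sInf {r : ℝ | ∃ m ∈ Mman C I, r = ∏ i ∈ I, |m i|})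
    (γ : ℝ) (hγ : γ = sInf {r : ℝ | ∃ I ∈ Jcal C, r = γI I})
    (R : ℝ → ℝ)
    (hR : R = fun t => ((Ncal C : ℝ) / 2) * α * Real.log t -
      ((Ncal C : ℝ) / 2) * Real.log (Real.log (Real.sqrt t)) -
      (Ncal C : ℝ) * Real.log (K * α ^ (α / 2) * (2 * Real.sqrt Real.pi)) +
      (d / 2 : ℝ) * Real.log (2 * Real.pi))
    (Ifun : (Fin d → ℝ) → ℝ)
    (hIfun : Ifun = fun y => (∑ i, y i ^ 2) / 2 + (d / 2 : ℝ) * Real.log (2 * Real.pi))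
    (Bt : ℝ → Set (Fin d → ℝ))
    (hBt : Bt = fun t => {y | t ≤ quadForm C (fun i => Sαinv (normCDF (y i)))}) :
    Tendsto (fun t => sInf {r : ℝ | ∃ y ∈ Bt t, r = Ifun y} - (R t + α * Real.log γ))
      atTop (𝓝 0) := by
  choose Y hY using fun x => exists_normCDF_eq (hrange x)
  have hSY : ∀ x, Sαinv (normCDF (Y x)) = x := fun x => by rw [hY, hinv_left]
  have hYS : ∀ y, Y (Sαinv (normCDF y)) = y := fun y =>
    normCDF_strictMono.injective (by rw [hY, hinv_right _ (normCDF_mem_Ioo y)])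
  have hA : 0 < K * α ^ ((α - 1) / 2) := by positivity
  have hψ := hasCostProfile_normal_quantile hα hA hY htail_left htail_right
  have hψ0 : ∀ x, 0 ≤ Y x ^ 2 / 2 := fun x => by positivity
  have hc₀ : Y (Sαinv (normCDF 0)) ^ 2 / 2 = 0 := by rw [hYS]; norm_num
  have hκ : K * α ^ ((α - 1) / 2) * Real.sqrt α = K * α ^ (α / 2) := by
    rw [Real.sqrt_eq_rpow, mul_assoc, ← Real.rpow_add hα]
    ring_nf
  rw [hκ] at hψ
  refine Metric.tendsto_nhds.2 fun ε hε => ?_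
  have hlow := sum_cost_lower_bound hnondeg hpos hα hψ hψ0
    (fun I hI m hm hq => log_infProd_le hnondeg hpos hγI hγ hI hm hq) (half_pos hε)
  have hup := exists_sum_cost_le hα hψ hc₀
    (fun ε hε => exists_sum_log_le hnondeg hpos hγI hγ hε) (half_pos hε)
  have hsqrt : Tendsto Real.sqrt atTop atTop := Real.tendsto_sqrt_atTop
  filter_upwards [eventually_gt_atTop 0, hsqrt.eventually hlow, hsqrt.eventually hup]
    with t ht hlowt hupt
  rw [Real.sq_sqrt ht.le] at hlowt hupt
  have hRt : R t = (Ncal C : ℝ) * costProfile α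
      (Real.log (K * α ^ (α / 2) * (2 * Real.sqrt Real.pi))) (Real.sqrt t) +
      (d / 2 : ℝ) * Real.log (2 * Real.pi) := by
    rw [hR]
    simp only [costProfile, Real.log_sqrt ht.le]
    ring
  have hlowb : ∀ r ∈ {r : ℝ | ∃ y ∈ Bt t, r = Ifun y}, R t + α * Real.log γ - ε / 2 ≤ r := by
    rintro r ⟨y, hy, rfl⟩
    rw [hBt] at hy
    have h := hlowt _ hy
    simp only [hYS] at h
    rw [hIfun, hRt]
    simp only [Finset.sum_div]
    linarith
  obtain ⟨x, hx, hxle⟩ := hupt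
  have hmem : Ifun (fun i => Y (x i)) ∈ {r : ℝ | ∃ y ∈ Bt t, r = Ifun y} := by
    refine ⟨_, ?_, rfl⟩
    rw [hBt]
    simpa only [mem_ofPred_eq, hSY] using hx
  have hle := csInf_le ⟨_, hlowb⟩ hmem
  have hge := le_csInf ⟨_, hmem⟩ hlowb
  have hI : Ifun (fun i => Y (x i)) ≤ R t + α * Real.log γ + ε / 2 := by
    rw [hIfun, hRt]
    simp only [Finset.sum_div]
    linarith
  rw [Real.dist_eq, sub_zero, abs_lt]
  constructor <;> linarith

end
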